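/- There exist absolute constants C > 0 and c ≥ 1 with the following property. For every finite simple connected graph G on vertex set V with n vertices, m edges, and minimum degree δ ≥ 1, there exists a partition P of V into nonempty pairwise disjoint parts such that: (i) for every non-trivial minimum cut S of G, S is a union of parts of P; (ii) the number of edges of G whose endpoints lie in two distinct parts of P is at most C·n·(log(n+2))^c; and (iii) the number of parts of P is at most C·n·(log(n+2))^c/δ. -/

import Mathlib

open scoped Classical
open Finset

noncomputable section

variable {V : Type*} [Fintype V]

/-- The set of edges of `G` with exactly one endpoint in `S`. -/
def bdry (G : SimpleGraph V) (S : Finset V) : Finset (Sym2 V) :=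
  G.edgeFinset.filter fun e => ∃ u v, u ∈ S ∧ v ∉ S ∧ e = s(u, v)

/-- The edge connectivity of `G`: the minimum of `|∂S|` over nonempty proper `S ⊆ V`. -/
def econn (G : SimpleGraph V) : ℕ :=
  sInf {k | ∃ S : Finset V, S.Nonempty ∧ S ≠ Finset.univ ∧ (bdry G S).card = k}

/-- `S` is a non-trivial minimum cut: nonempty, proper, realizing the edge connectivity,
with at least two vertices on each side. -/
def IsNontrivialMinCut (G : SimpleGraph V) (S : Finset V) : Prop :=
  S.Nonempty ∧ S ≠ Finset.univ ∧ (bdry G S).card = econn G ∧ 2 ≤ S.card ∧ 2 ≤ Sᶜ.card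

/-- `P` is a partition of the vertex set into nonempty, pairwise disjoint parts. -/
def IsPartition (P : Finset (Finset V)) : Prop :=
  (∀ p ∈ P, p.Nonempty) ∧
  (∀ p ∈ P, ∀ q ∈ P, p ≠ q → Disjoint p q) ∧
  P.sup id = Finset.univ

/-- The edges of `G` whose endpoints lie in two distinct parts of `P`. -/
def crossEdges (G : SimpleGraph V) (P : Finset (Finset V)) : Finset (Sym2 V) :=
  G.edgeFinset.filter fun e => ¬ ∃ p ∈ P, ∀ x ∈ e, x ∈ p

/-- The number of ordered pairs in `A × B` that are adjacent in `G`. -/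
def edgeCount (G : SimpleGraph V) (A B : Finset V) : ℤ :=
  ∑ u ∈ A, ∑ v ∈ B, if G.Adj u v then 1 else 0

/-- The number of edges leaving `S`. -/
def cutSize (G : SimpleGraph V) (S : Finset V) : ℤ := edgeCount G S Sᶜ

theorem edgeCount_union_left {α : Type*} (G : SimpleGraph α) {A B : Finset α} (h : Disjoint A B)
    (C : Finset α) : edgeCount G (A ∪ B) C = edgeCount G A C + edgeCount G B C :=
  Finset.sum_union h

theorem edgeCount_comm {α : Type*} (G : SimpleGraph α) (A B : Finset α) :
    edgeCount G A B = edgeCount G B A := by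
  unfold edgeCount
  rw [Finset.sum_comm]
  simp only [G.adj_comm]

theorem edgeCount_union_right {α : Type*} (G : SimpleGraph α) (C : Finset α) {A B : Finset α}
    (h : Disjoint A B) : edgeCount G C (A ∪ B) = edgeCount G C A + edgeCount G C B := by
  rw [edgeCount_comm, edgeCount_union_left G h, edgeCount_comm G A, edgeCount_comm G B]

theorem edgeCount_mono {α : Type*} (G : SimpleGraph α) {A A' B B' : Finset α}
    (hA : A ⊆ A') (hB : B ⊆ B') :
    edgeCount G A B ≤ edgeCount G A' B' := by
  have nonneg (u v : α) : (0 : ℤ) ≤ if G.Adj u v then 1 else 0 := by split_ifs <;> simp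
  unfold edgeCount
  calc _ ≤ ∑ u ∈ A, ∑ v ∈ B', (if G.Adj u v then 1 else 0 : ℤ) :=
        Finset.sum_le_sum fun u _ =>
          Finset.sum_le_sum_of_subset_of_nonneg hB fun v _ _ => nonneg u v
    _ ≤ _ := Finset.sum_le_sum_of_subset_of_nonneg hA
        fun u _ _ => Finset.sum_nonneg fun v _ => nonneg u v

theorem edgeCount_singleton_le_card {α : Type*} (G : SimpleGraph α) (v : α) (B : Finset α) :
    edgeCount G {v} B ≤ B.card := by
  simp only [edgeCount, Finset.sum_singleton, Finset.sum_boole, Nat.cast_le]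
  exact Finset.card_filter_le _ _

theorem mul_card_le_edgeCount {α : Type*} (G : SimpleGraph α) {A B : Finset α} {k : ℤ}
    (h : ∀ u ∈ A, k ≤ edgeCount G {u} B) : k * A.card ≤ edgeCount G A B := by
  have := Finset.card_nsmul_le_sum A (fun u => edgeCount G {u} B) k h
  simpa [edgeCount, mul_comm] using this

theorem cutSize_compl (G : SimpleGraph V) (S : Finset V) : cutSize G Sᶜ = cutSize G S := by
  rw [cutSize, cutSize, compl_compl, edgeCount_comm]

theorem cutSize_add_cutSize (G : SimpleGraph V) {A B : Finset V} (h : Disjoint A B) :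
    cutSize G A + cutSize G B = cutSize G (A ∪ B) + 2 * edgeCount G A B := by
  have hA : Aᶜ = B ∪ (A ∪ B)ᶜ := by
    ext x; have h' : x ∈ A → x ∉ B := fun hx => Finset.disjoint_left.1 h hx
    simp; tauto
  have hB : Bᶜ = A ∪ (A ∪ B)ᶜ := by
    ext x; have h' : x ∈ A → x ∉ B := fun hx => Finset.disjoint_left.1 h hx
    simp; tauto
  have hA' : Disjoint B (A ∪ B)ᶜ := by
    rw [Finset.disjoint_left]; intro x hx; simp [hx]
  have hB' : Disjoint A (A ∪ B)ᶜ := by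
    rw [Finset.disjoint_left]; intro x hx; simp [hx]
  unfold cutSize
  rw [edgeCount_union_left G h, hA, hB, edgeCount_union_right G A hA',
    edgeCount_union_right G B hB', edgeCount_comm G B A]
  ring

theorem cutSize_singleton (G : SimpleGraph V) (v : V) : cutSize G {v} = G.degree v := by
  simp only [cutSize, edgeCount, Finset.sum_singleton, Finset.sum_boole, Nat.cast_inj]
  rw [← G.card_neighborFinset_eq_degree]
  congr 1
  ext u
  simp only [Finset.mem_filter, Finset.mem_compl, Finset.mem_singleton,
    SimpleGraph.mem_neighborFinset, and_iff_right_iff_imp]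
  exact fun h => h.ne'

theorem edgeCount_add_edgeCount_compl (G : SimpleGraph V) (v : V) (X : Finset V) :
    edgeCount G {v} X + edgeCount G {v} Xᶜ = G.degree v := by
  rw [← edgeCount_union_right G _ disjoint_compl_right, Finset.union_compl]
  simp only [edgeCount, Finset.sum_singleton, Finset.sum_boole, Nat.cast_inj]
  rw [← G.card_neighborFinset_eq_degree]
  congr 1
  ext u
  simp

theorem card_bdry (G : SimpleGraph V) (S : Finset V) : ((bdry G S).card : ℤ) = cutSize G S := by
  have himg : bdry G S =
      ((S ×ˢ Sᶜ).filter fun p => G.Adj p.1 p.2).image fun p => s(p.1, p.2) := by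
    ext e
    simp only [bdry, Finset.mem_filter, Finset.mem_image, Finset.mem_product, Finset.mem_compl,
      Prod.exists, SimpleGraph.mem_edgeFinset]
    constructor
    · rintro ⟨he, u, v, hu, hv, rfl⟩
      exact ⟨u, v, ⟨⟨hu, hv⟩, he⟩, rfl⟩
    · rintro ⟨u, v, ⟨⟨hu, hv⟩, he⟩, rfl⟩
      exact ⟨he, u, v, hu, hv, rfl⟩
  rw [himg, Finset.card_image_of_injOn]
  · rw [cutSize, edgeCount, ← Finset.sum_product', Finset.sum_boole]
  · rintro ⟨a, b⟩ hab ⟨c, d⟩ hcd h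
    simp only [Finset.coe_filter, Finset.mem_product, Finset.mem_compl, Set.mem_ofPred_eq]
      at hab hcd
    simp only [Sym2.eq_iff] at h
    rcases h with ⟨rfl, rfl⟩ | ⟨rfl, rfl⟩
    · rfl
    · exact absurd hab.1.1 hcd.1.2

/-- A family of pairwise disjoint sets, each of size at least `δ / 10`. -/
def IsPacking (δ : ℕ) (F : Finset (Finset V)) : Prop :=
  (∀ X ∈ F, δ ≤ 10 * X.card) ∧ ∀ X ∈ F, ∀ Y ∈ F, X ≠ Y → Disjoint X Y

/-- The cost of a cluster; a packing of least total cost has highly connected clusters. -/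
def weight (G : SimpleGraph V) (δ : ℕ) (X : Finset V) : ℤ :=
  5 * cutSize G X - δ * X.card - 15 * δ

/-- A packing of least total weight. -/
def IsOptimalPacking (G : SimpleGraph V) (δ : ℕ) (F : Finset (Finset V)) : Prop :=
  IsPacking δ F ∧
    ∀ F' : Finset (Finset V), IsPacking δ F' → ∑ X ∈ F, weight G δ X ≤ ∑ X ∈ F', weight G δ X

theorem exists_isOptimalPacking (G : SimpleGraph V) (δ : ℕ) :
    ∃ F, IsOptimalPacking G δ F := by
  obtain ⟨F, hF, hmin⟩ := Finset.exists_min_image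
    (Finset.univ.filter fun F : Finset (Finset V) => IsPacking δ F)
    (fun F => ∑ X ∈ F, weight G δ X)
    ⟨∅, Finset.mem_filter.2 ⟨Finset.mem_univ _, by simp [IsPacking]⟩⟩
  exact ⟨F, by simpa using hF, fun F' hF' => hmin F' (by simpa using hF')⟩

theorem IsOptimalPacking.weight_le_sum {G : SimpleGraph V} {δ : ℕ} {F A : Finset (Finset V)}
    (hF : IsOptimalPacking G δ F) (hδ : 0 < δ) {X : Finset V} (hX : X ∈ F)
    (hA : IsPacking δ A) (hsub : ∀ Y ∈ A, Y ⊆ X) :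
    weight G δ X ≤ ∑ Y ∈ A, weight G δ Y := by
  have hdisj {Y Z : Finset V} (hY : Y ∈ F.erase X) (hZ : Z ∈ A) : Disjoint Y Z :=
    (hF.1.2 Y (Finset.mem_of_mem_erase hY) X hX (Finset.ne_of_mem_erase hY)).mono_right
      (hsub Z hZ)
  have hFA : Disjoint (F.erase X) A := by
    rw [Finset.disjoint_left]
    intro Y hY hY'
    have h0 := hdisj hY hY'
    rw [disjoint_self] at h0
    have := hA.1 Y hY'
    simp [h0] at this
    omega
  have hpack : IsPacking δ (F.erase X ∪ A) := by
    constructor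
    · intro Y hY
      rcases Finset.mem_union.1 hY with hY | hY
      · exact hF.1.1 Y (Finset.mem_of_mem_erase hY)
      · exact hA.1 Y hY
    · intro Y hY Z hZ hne
      rcases Finset.mem_union.1 hY with hY | hY <;> rcases Finset.mem_union.1 hZ with hZ | hZ
      · exact hF.1.2 Y (Finset.mem_of_mem_erase hY) Z (Finset.mem_of_mem_erase hZ) hne
      · exact hdisj hY hZ
      · exact (hdisj hZ hY).symm
      · exact hA.2 Y hY Z hZ hne
  have h := hF.2 _ hpack
  rw [Finset.sum_union hFA, ← Finset.sum_erase_add F _ hX] at h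
  linarith

theorem mul_sub_le_cutSize {G : SimpleGraph V} {δ : ℕ} (hdeg : ∀ v, δ ≤ G.degree v)
    (X : Finset V) : ((δ : ℤ) - X.card) * X.card ≤ cutSize G X := by
  refine mul_card_le_edgeCount G fun u _ => ?_
  have h1 := edgeCount_add_edgeCount_compl G u X
  have h2 := edgeCount_singleton_le_card G u X
  have h3 : (δ : ℤ) ≤ G.degree u := by exact_mod_cast hdeg u
  linarith

theorem IsOptimalPacking.lt_card {G : SimpleGraph V} {δ : ℕ} {F : Finset (Finset V)}
    (hF : IsOptimalPacking G δ F) (hδ : 50 ≤ δ) (hdeg : ∀ v, δ ≤ G.degree v)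
    {X : Finset V} (hX : X ∈ F) : δ + 10 ≤ 10 * X.card := by
  by_contra! hlt
  have h0 := hF.weight_le_sum (A := ∅) (by omega) hX (by simp [IsPacking]) (by simp)
  have h1 := mul_sub_le_cutSize hdeg X
  have h2 := hF.1.1 X hX
  have h5 : (5 : ℤ) ≤ X.card := by omega
  have hlt' : (10 : ℤ) * X.card < δ + 10 := by exact_mod_cast hlt
  have hδ' : (50 : ℤ) ≤ δ := by exact_mod_cast hδ
  simp only [weight, Finset.sum_empty] at h0
  nlinarith [mul_nonneg (sub_nonneg.2 hδ') (sub_nonneg.2 h5)]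

theorem IsOptimalPacking.degree_le {G : SimpleGraph V} {δ : ℕ} {F : Finset (Finset V)}
    (hF : IsOptimalPacking G δ F) (hδ : 50 ≤ δ) (hdeg : ∀ v, δ ≤ G.degree v)
    {X : Finset V} (hX : X ∈ F) {v : V} (hv : v ∈ X) :
    4 * (δ : ℤ) ≤ 10 * edgeCount G {v} X := by
  have hc := hF.lt_card hδ hdeg hX
  have hcard := Finset.card_erase_add_one hv
  have h0 := hF.weight_le_sum (A := {X.erase v}) (by omega) hX
    ⟨by simp; omega, by simp⟩ (by simpa using Finset.erase_subset v X)
  have h1 := cutSize_add_cutSize G (A := {v}) (B := X.erase v) (by simp)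
  rw [cutSize_singleton, ← Finset.insert_eq, Finset.insert_erase hv] at h1
  have h2 : edgeCount G {v} (X.erase v) ≤ edgeCount G {v} X :=
    edgeCount_mono G subset_rfl (Finset.erase_subset v X)
  have h3 : (δ : ℤ) ≤ G.degree v := by exact_mod_cast hdeg v
  have h4 : (X.card : ℤ) = (X.erase v).card + 1 := by exact_mod_cast hcard.symm
  simp only [weight, Finset.sum_singleton, h4] at h0
  linarith

theorem edgeCount_inter_sdiff_le (G : SimpleGraph V) (X S : Finset V) :
    edgeCount G (X ∩ S) (X \ S) ≤ cutSize G S :=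
  edgeCount_mono G Finset.inter_subset_right fun x hx => by simp_all

theorem IsOptimalPacking.small_side {G : SimpleGraph V} {δ : ℕ} {F : Finset (Finset V)}
    (hF : IsOptimalPacking G δ F) (hδ : 0 < δ) {X : Finset V} (hX : X ∈ F) {S : Finset V}
    (hS : cutSize G S ≤ δ) : 10 * (X ∩ S).card < δ ∨ 10 * (X \ S).card < δ := by
  by_contra! h
  have hd : Disjoint (X ∩ S) (X \ S) := (Finset.disjoint_sdiff_inter X S).symm
  have hne : X ∩ S ≠ X \ S := by
    intro he
    rw [← he, disjoint_self] at hd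
    have h1 := h.1
    simp [hd] at h1
    omega
  have h0 := hF.weight_le_sum (A := {X ∩ S, X \ S}) hδ hX
    ⟨by simpa using h, by
      intro Y hY Z hZ hYZ
      simp only [Finset.mem_insert, Finset.mem_singleton] at hY hZ
      rcases hY with rfl | rfl <;> rcases hZ with rfl | rfl
      · exact absurd rfl hYZ
      · exact hd
      · exact hd.symm
      · exact absurd rfl hYZ⟩
    (by simp)
  rw [Finset.sum_pair hne] at h0
  have hu : X ∩ S ∪ X \ S = X := by
    ext x; simp; tauto
  have h1 := cutSize_add_cutSize G hd
  have h2 := Finset.card_union_of_disjoint hd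
  rw [hu] at h1 h2
  have h3 := edgeCount_inter_sdiff_le G X S
  have h4 : (X.card : ℤ) = (X ∩ S).card + (X \ S).card := by exact_mod_cast h2
  have h5 : (0 : ℤ) < δ := by exact_mod_cast hδ
  simp only [weight, h4] at h0
  linarith

/-- The vertices of `X` with clearly more than half of their neighbours in `X`. -/
def core (G : SimpleGraph V) (X : Finset V) : Finset V :=
  X.filter fun v => (G.degree v : ℤ) + 6 < 2 * edgeCount G {v} X

theorem disjoint_core_of_small {G : SimpleGraph V} {δ : ℕ} (hδ : 0 < δ) {X S : Finset V}
    (hX : ∀ v ∈ X, 4 * (δ : ℤ) ≤ 10 * edgeCount G {v} X) (hS2 : 2 ≤ S.card)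
    (hSδ : cutSize G S ≤ δ)
    (hmin : ∀ T : Finset V, T.Nonempty → T ≠ Finset.univ → cutSize G S ≤ cutSize G T)
    (hsmall : 10 * (X ∩ S).card < δ) : Disjoint (core G X) S := by
  have hd : Disjoint (X ∩ S) (X \ S) := (Finset.disjoint_sdiff_inter X S).symm
  have hu : X ∩ S ∪ X \ S = X := by
    ext x; simp; tauto
  have hδ' : (0 : ℤ) < δ := by exact_mod_cast hδ
  have hsmall' : (10 : ℤ) * (X ∩ S).card < δ := by exact_mod_cast hsmall
  have hsplit (u : V) : edgeCount G {u} X ≤ (X ∩ S).card + edgeCount G {u} (X \ S) := by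
    have h1 := edgeCount_union_right G {u} hd
    rw [hu] at h1
    linarith [edgeCount_singleton_le_card G u (X ∩ S)]
  have hcard : ((X ∩ S).card : ℤ) ≤ 3 := by
    have h1 : (3 * (δ : ℤ)) * (X ∩ S).card ≤ 10 * edgeCount G (X ∩ S) (X \ S) := by
      have h2 := Finset.card_nsmul_le_sum (X ∩ S) (fun u => 10 * edgeCount G {u} (X \ S))
        (3 * (δ : ℤ)) fun u huA => by
          have h3 := hX u (Finset.mem_of_mem_inter_left huA)
          have h4 := hsplit u
          linarith
      rw [← Finset.mul_sum] at h2
      simpa [edgeCount, mul_comm] using h2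
    have h2 := edgeCount_inter_sdiff_le G X S
    by_contra! h
    nlinarith [mul_le_mul_of_nonneg_left (Int.add_one_le_iff.2 h) hδ'.le]
  rw [Finset.disjoint_left]
  intro v hv hvS
  simp only [core, Finset.mem_filter] at hv
  have hne : (S.erase v).Nonempty := by
    rw [← Finset.card_pos, Finset.card_erase_of_mem hvS]; omega
  have hne' : S.erase v ≠ Finset.univ := fun h => by
    have := Finset.mem_univ v
    rw [← h] at this
    simp at this
  have h1 := hmin _ hne hne'
  have h2 := cutSize_add_cutSize G (A := {v}) (B := S.erase v) (by simp)
  rw [cutSize_singleton, ← Finset.insert_eq, Finset.insert_erase hvS] at h2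
  have hd' : Disjoint (S.erase v) (X \ S) := by
    rw [Finset.disjoint_left]; intro x hx; simp_all
  have h3 : edgeCount G {v} (S.erase v) + edgeCount G {v} (X \ S) ≤ G.degree v := by
    rw [← edgeCount_union_right G _ hd', ← cutSize_singleton]
    refine edgeCount_mono G subset_rfl fun x hx => ?_
    simp only [Finset.mem_union, Finset.mem_erase, Finset.mem_sdiff] at hx
    simp only [Finset.mem_compl, Finset.mem_singleton]
    rintro rfl
    tauto
  linarith [hsplit v, hv.2]

theorem mul_card_le_mul_card_core_add {G : SimpleGraph V} {δ : ℕ} (hδ : 12 ≤ δ)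
    (hdeg : ∀ v, δ ≤ G.degree v) (X : Finset V) :
    (δ : ℤ) * X.card ≤ δ * (core G X).card + 4 * cutSize G X := by
  set Y := X.filter fun v => ¬ (G.degree v : ℤ) + 6 < 2 * edgeCount G {v} X with hY
  have h1 : (core G X).card + Y.card = X.card := Finset.card_filter_add_card_filter_not _
  have h1' : (X.card : ℤ) = (core G X).card + Y.card := by exact_mod_cast h1.symm
  have h2 := Finset.card_nsmul_le_sum Y (fun u => 4 * edgeCount G {u} Xᶜ) (δ : ℤ)
    fun u hu => by
      simp only [hY, Finset.mem_filter, not_lt] at hu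
      have h3 := edgeCount_add_edgeCount_compl G u X
      have h4 : (δ : ℤ) ≤ G.degree u := by exact_mod_cast hdeg u
      have h5 : (12 : ℤ) ≤ δ := by exact_mod_cast hδ
      linarith [hu.2]
  rw [← Finset.mul_sum] at h2
  have h3 : (δ : ℤ) * Y.card ≤ 4 * edgeCount G Y Xᶜ := by
    simpa [edgeCount, mul_comm] using h2
  have h4 : edgeCount G Y Xᶜ ≤ cutSize G X :=
    edgeCount_mono G (Finset.filter_subset _ _) subset_rfl
  rw [h1', mul_add]
  linarith

theorem IsOptimalPacking.card_add_le {G : SimpleGraph V} {δ : ℕ} {F : Finset (Finset V)}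
    (hF : IsOptimalPacking G δ F) (hδ : 12 ≤ δ) (hn : δ ≤ Fintype.card V)
    (hdeg : ∀ v, δ ≤ G.degree v) :
    δ * (F.card + (F.biUnion (core G))ᶜ.card) ≤ 280 * Fintype.card V := by
  have hcore : (F.biUnion (core G)).card = ∑ X ∈ F, (core G X).card :=
    Finset.card_biUnion fun X hX Y hY hne => (hF.1.2 X hX Y hY hne).mono
      (Finset.filter_subset _ _) (Finset.filter_subset _ _)
  have hsum : ∑ X ∈ F, X.card ≤ Fintype.card V := by
    rw [← Finset.card_biUnion (fun X hX Y hY hne => hF.1.2 X hX Y hY hne)]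
    exact Finset.card_le_univ _
  have hsum' : ∑ X ∈ F, (X.card : ℤ) ≤ Fintype.card V := by exact_mod_cast hsum
  have hbad := Finset.card_add_card_compl (F.biUnion (core G))
  rw [hcore] at hbad
  have hbad' : ∑ X ∈ F, ((core G X).card : ℤ) + (F.biUnion (core G))ᶜ.card = Fintype.card V := by
    exact_mod_cast hbad
  have hk : (δ : ℤ) * F.card ≤ 10 * ∑ X ∈ F, (X.card : ℤ) := by
    have := Finset.card_nsmul_le_sum F (fun X => 10 * (X.card : ℤ)) δ
      fun X hX => by exact_mod_cast hF.1.1 X hX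
    rw [← Finset.mul_sum] at this
    simpa [mul_comm] using this
  have hw := hF.2 {Finset.univ} ⟨by simp; omega, by simp⟩
  have huniv : cutSize G (Finset.univ : Finset V) = 0 := by simp [cutSize, edgeCount]
  simp only [weight, Finset.sum_singleton, huniv, Finset.sum_sub_distrib, ← Finset.mul_sum,
    Finset.sum_const, Finset.card_univ, Finset.card_singleton, Nat.cast_one, nsmul_eq_mul] at hw
  have hc := Finset.sum_le_sum fun X (_ : X ∈ F) => mul_card_le_mul_card_core_add hδ hdeg X
  rw [Finset.sum_add_distrib, ← Finset.mul_sum, ← Finset.mul_sum, ← Finset.mul_sum] at hc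
  have hcut : 0 ≤ ∑ X ∈ F, cutSize G X := Finset.sum_nonneg fun X _ =>
    Finset.sum_nonneg fun u _ => Finset.sum_nonneg fun v _ => by split_ifs <;> simp
  have hδ' : (12 : ℤ) ≤ δ := by exact_mod_cast hδ
  have hmul := mul_le_mul_of_nonneg_left hsum' (by linarith : (0 : ℤ) ≤ δ)
  have hfin : (δ : ℤ) * (F.card + (F.biUnion (core G))ᶜ.card) ≤ 280 * Fintype.card V := by
    rw [← hbad'] at hw hmul hsum' ⊢
    linarith
  exact_mod_cast hfin

theorem econn_le (G : SimpleGraph V) {T : Finset V} (hT : T.Nonempty) (hT' : T ≠ Finset.univ) :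
    (econn G : ℤ) ≤ cutSize G T := by
  rw [← card_bdry]
  exact Int.ofNat_le.2 (Nat.sInf_le ⟨T, hT, hT', rfl⟩)

theorem econn_le_minDegree (G : SimpleGraph V) (hδ : 1 ≤ G.minDegree) :
    econn G ≤ G.minDegree := by
  have : Nonempty V := by
    by_contra h
    rw [not_nonempty_iff] at h
    simp at hδ
  obtain ⟨v, hv⟩ := G.exists_minimal_degree_vertex
  have hv' : 0 < G.degree v := by omega
  obtain ⟨w, hw⟩ := (G.degree_pos_iff_exists_adj v).1 hv'
  have h := econn_le G (Finset.singleton_nonempty v) fun h => hw.ne' <| by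
    have := Finset.mem_univ w
    rw [← h] at this
    simpa using this
  rw [cutSize_singleton, ← hv] at h
  exact_mod_cast h

/-- The vertices that no non-trivial minimum cut separates from `v`. -/
def atom (G : SimpleGraph V) (v : V) : Finset V :=
  Finset.univ.filter fun u => ∀ S, IsNontrivialMinCut G S → (u ∈ S ↔ v ∈ S)

theorem mem_atom {G : SimpleGraph V} {u v : V} :
    u ∈ atom G v ↔ ∀ S, IsNontrivialMinCut G S → (u ∈ S ↔ v ∈ S) := by
  simp [atom]

theorem mem_atom_self (G : SimpleGraph V) (v : V) : v ∈ atom G v :=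
  mem_atom.2 fun _ _ => Iff.rfl

theorem atom_eq_of_mem {G : SimpleGraph V} {u v : V} (h : u ∈ atom G v) :
    atom G u = atom G v := by
  rw [mem_atom] at h
  ext x
  rw [mem_atom, mem_atom]
  exact forall₂_congr fun S hS => by rw [h S hS]

/-- The partition of the vertices into atoms of the non-trivial minimum cuts. -/
def atoms (G : SimpleGraph V) : Finset (Finset V) := Finset.univ.image (atom G)

theorem isPartition_atoms (G : SimpleGraph V) : IsPartition (atoms G) := by
  refine ⟨?_, ?_, ?_⟩
  · simp only [atoms, Finset.mem_image, Finset.mem_univ, true_and]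
    rintro _ ⟨v, rfl⟩
    exact ⟨v, mem_atom_self G v⟩
  · simp only [atoms, Finset.mem_image, Finset.mem_univ, true_and]
    rintro _ ⟨u, rfl⟩ _ ⟨v, rfl⟩ hne
    rw [Finset.disjoint_left]
    exact fun x hu hv => hne ((atom_eq_of_mem hu).symm.trans (atom_eq_of_mem hv))
  · ext x
    simp only [Finset.mem_sup, Finset.mem_univ, iff_true]
    exact ⟨atom G x, Finset.mem_image_of_mem _ (Finset.mem_univ x), mem_atom_self G x⟩

theorem subset_or_disjoint_of_mem_atoms {G : SimpleGraph V} {S p : Finset V}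
    (hS : IsNontrivialMinCut G S) (hp : p ∈ atoms G) : p ⊆ S ∨ Disjoint p S := by
  simp only [atoms, Finset.mem_image, Finset.mem_univ, true_and] at hp
  obtain ⟨v, rfl⟩ := hp
  by_cases hv : v ∈ S
  · exact Or.inl fun x hx => (mem_atom.1 hx S hS).2 hv
  · exact Or.inr (Finset.disjoint_left.2 fun x hx hxS => hv ((mem_atom.1 hx S hS).1 hxS))

/-- The edges between distinct atoms that have both endpoints in `W`. -/
def crossEdgesWithin (G : SimpleGraph V) (W : Finset V) : Finset (Sym2 V) :=
  (crossEdges G (atoms G)).filter fun e => ∀ x ∈ e, x ∈ W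

theorem card_crossEdgesWithin_add_le (G : SimpleGraph V) (W : Finset V) (hW : W.Nonempty) :
    (crossEdgesWithin G W).card + econn G ≤
      econn G * (W.image (atom G)).card := by
  induction W using Finset.strongInduction with
  | H W ih =>
  by_cases hsep : ∃ u ∈ W, ∃ v ∈ W, atom G u ≠ atom G v
  · obtain ⟨u, hu, v, hv, hne⟩ := hsep
    have hnot : u ∉ atom G v := fun h => hne (atom_eq_of_mem h)
    rw [mem_atom] at hnot
    push Not at hnot
    obtain ⟨S, hS, hSuv⟩ := hnot
    have hI : (W ∩ S).Nonempty := by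
      rcases hSuv with h | h
      · exact ⟨u, by simp [hu, h.1]⟩
      · exact ⟨v, by simp [hv, h.2]⟩
    have hD : (W \ S).Nonempty := by
      rcases hSuv with h | h
      · exact ⟨v, by simp [hv, h.2]⟩
      · exact ⟨u, by simp [hu, h.1]⟩
    have hI' : W ∩ S ⊂ W := by
      refine Finset.ssubset_iff_subset_ne.2 ⟨Finset.inter_subset_left, fun h => ?_⟩
      obtain ⟨x, hx⟩ := hD
      rw [Finset.mem_sdiff] at hx
      rw [← h] at hx
      exact hx.2 (Finset.mem_of_mem_inter_right hx.1)
    have hD' : W \ S ⊂ W := by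
      refine Finset.ssubset_iff_subset_ne.2 ⟨Finset.sdiff_subset, fun h => ?_⟩
      obtain ⟨x, hx⟩ := hI
      rw [Finset.mem_inter] at hx
      rw [← h] at hx
      exact (Finset.mem_sdiff.1 hx.1).2 hx.2
    have h1 := ih _ hI' hI
    have h2 := ih _ hD' hD
    have hsub : crossEdgesWithin G W ⊆
        crossEdgesWithin G (W ∩ S) ∪ crossEdgesWithin G (W \ S) ∪ bdry G S := by
      intro e
      induction e with
      | _ a b =>
      simp only [crossEdgesWithin, Finset.mem_filter, Finset.mem_union, Sym2.mem_iff,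
        forall_eq_or_imp, forall_eq, Finset.mem_inter, Finset.mem_sdiff]
      rintro ⟨he, ha, hb⟩
      have hadj : s(a, b) ∈ G.edgeFinset := (Finset.mem_filter.1 he).1
      by_cases haS : a ∈ S <;> by_cases hbS : b ∈ S
      · exact Or.inl (Or.inl ⟨he, ⟨ha, haS⟩, hb, hbS⟩)
      · exact Or.inr (Finset.mem_filter.2 ⟨hadj, a, b, haS, hbS, rfl⟩)
      · exact Or.inr (Finset.mem_filter.2 ⟨hadj, b, a, hbS, haS, Sym2.eq_swap⟩)
      · exact Or.inl (Or.inr ⟨he, ⟨ha, haS⟩, hb, hbS⟩)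
    have h3 := (Finset.card_le_card hsub).trans (Finset.card_union_le _ _)
    have h4 := Finset.card_union_le (crossEdgesWithin G (W ∩ S)) (crossEdgesWithin G (W \ S))
    have hdisj : Disjoint ((W ∩ S).image (atom G)) ((W \ S).image (atom G)) := by
      rw [Finset.disjoint_left]
      intro p hp hp'
      obtain ⟨x, hx, rfl⟩ := Finset.mem_image.1 hp
      obtain ⟨y, hy, hxy⟩ := Finset.mem_image.1 hp'
      have hyx : y ∈ atom G x := hxy ▸ mem_atom_self G y
      rw [Finset.mem_sdiff] at hy
      exact hy.2 ((mem_atom.1 hyx S hS).2 (Finset.mem_of_mem_inter_right hx))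
    have h5 : ((W ∩ S).image (atom G)).card + ((W \ S).image (atom G)).card ≤
        (W.image (atom G)).card := by
      rw [← Finset.card_union_of_disjoint hdisj]
      exact Finset.card_le_card (Finset.union_subset
        (Finset.image_subset_image Finset.inter_subset_left)
        (Finset.image_subset_image Finset.sdiff_subset))
    have h6 := Nat.mul_le_mul_left (econn G) h5
    rw [mul_add] at h6
    have h7 := hS.2.2.1
    omega
  · push Not at hsep
    have hempty : crossEdgesWithin G W = ∅ := by
      rw [crossEdgesWithin, Finset.filter_eq_empty_iff]
      intro e he hmem
      refine (Finset.mem_filter.1 he).2 ?_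
      obtain ⟨w, hw⟩ := hW
      refine ⟨atom G w, Finset.mem_image_of_mem _ (Finset.mem_univ w), fun x hx => ?_⟩
      rw [hsep w hw x (hmem x hx)]
      exact mem_atom_self G x
    rw [hempty, Finset.card_empty, zero_add]
    exact Nat.le_mul_of_pos_right _ (Finset.card_pos.2 (hW.image _))

theorem card_crossEdges_atoms_le (G : SimpleGraph V) [Nonempty V] :
    (crossEdges G (atoms G)).card ≤ econn G * (atoms G).card := by
  have h := card_crossEdgesWithin_add_le G Finset.univ Finset.univ_nonempty
  simp only [crossEdgesWithin, Finset.mem_univ, implies_true, Finset.filter_true] at h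
  exact (Nat.le_add_right _ _).trans h

theorem IsOptimalPacking.core_unseparated {G : SimpleGraph V} {F : Finset (Finset V)}
    (hF : IsOptimalPacking G G.minDegree F) (hδ : 50 ≤ G.minDegree) {X : Finset V} (hX : X ∈ F)
    {u v : V} (hu : u ∈ core G X) (hv : v ∈ core G X) : atom G u = atom G v := by
  refine atom_eq_of_mem (mem_atom.2 fun S hS => ?_)
  obtain ⟨-, -, hcut, hS2, hSc2⟩ := hS
  have hcut' : cutSize G S = econn G := by rw [← card_bdry, hcut]
  have hle : (econn G : ℤ) ≤ G.minDegree := by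
    exact_mod_cast econn_le_minDegree G (by omega)
  have hXdeg : ∀ v ∈ X, 4 * (G.minDegree : ℤ) ≤ 10 * edgeCount G {v} X :=
    fun v hv => hF.degree_le hδ G.minDegree_le_degree hX hv
  rcases hF.small_side (by omega) hX (hcut'.trans_le hle) with h | h
  · have hd := Finset.disjoint_left.1 <| disjoint_core_of_small (by omega) hXdeg hS2
      (hcut'.trans_le hle) (fun T hT hT' => hcut'.trans_le (econn_le G hT hT')) h
    exact iff_of_false (hd hu) (hd hv)
  · have hcut'' : cutSize G Sᶜ = econn G := by rw [cutSize_compl, hcut']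
    have hd := Finset.disjoint_left.1 <| disjoint_core_of_small (by omega) hXdeg hSc2
      (hcut''.trans_le hle)
      (fun T hT hT' => hcut''.trans_le (econn_le G hT hT')) (by rwa [← Finset.sdiff_eq_inter_compl])
    have hu' := hd hu
    have hv' := hd hv
    simp only [Finset.mem_compl, not_not] at hu' hv'
    exact iff_of_true hu' hv'

theorem minDegree_mul_card_atoms_le (G : SimpleGraph V) [Nonempty V] :
    G.minDegree * (atoms G).card ≤ 280 * Fintype.card V := by
  rcases lt_or_ge G.minDegree 50 with hδ | hδ
  · have h : (atoms G).card ≤ Fintype.card V := Finset.card_image_le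
    exact Nat.mul_le_mul (by omega) h
  obtain ⟨F, hF⟩ := exists_isOptimalPacking G G.minDegree
  have hsub : atoms G ⊆ (F.biUnion (core G))ᶜ.image (atom G) ∪
      F.image fun X => if h : (core G X).Nonempty then atom G h.choose else ∅ := by
    intro p hp
    simp only [atoms, Finset.mem_image, Finset.mem_univ, true_and] at hp
    obtain ⟨v, rfl⟩ := hp
    by_cases hv : v ∈ F.biUnion (core G)
    · obtain ⟨X, hX, hvX⟩ := Finset.mem_biUnion.1 hv
      refine Finset.mem_union_right _ (Finset.mem_image.2 ⟨X, hX, ?_⟩)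
      have hne : (core G X).Nonempty := ⟨v, hvX⟩
      rw [dif_pos hne]
      exact hF.core_unseparated hδ hX hne.choose_spec hvX
    · exact Finset.mem_union_left _ (Finset.mem_image_of_mem _ (Finset.mem_compl.2 hv))
  have hcard : (atoms G).card ≤ F.card + (F.biUnion (core G))ᶜ.card := by
    refine (Finset.card_le_card hsub).trans ((Finset.card_union_le _ _).trans ?_)
    rw [add_comm]
    exact add_le_add Finset.card_image_le Finset.card_image_le
  exact (Nat.mul_le_mul_left _ hcard).trans <|
    hF.card_add_le (by omega) G.minDegree_lt_card.le G.minDegree_le_degree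

theorem stmt1 :
    ∃ C c : ℝ, 0 < C ∧ 1 ≤ c ∧
      ∀ (V : Type) [Fintype V], ∀ (G : SimpleGraph V) (n m δ : ℕ),
        G.Connected →
        n = Fintype.card V →
        m = G.edgeFinset.card →
        δ = G.minDegree →
        1 ≤ δ →
        ∃ P : Finset (Finset V),
          IsPartition P ∧
          (∀ S : Finset V, IsNontrivialMinCut G S →
            ∀ p ∈ P, p ⊆ S ∨ Disjoint p S) ∧
          ((crossEdges G P).card : ℝ) ≤ C * n * Real.log ((n : ℝ) + 2) ^ c ∧
          (P.card : ℝ) ≤ C * n * Real.log ((n : ℝ) + 2) ^ c / δ := by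
  refine ⟨280, 1, by norm_num, le_rfl, ?_⟩
  intro V _ G n m δ hG hn _ hδ h1
  have := hG.nonempty
  have hatoms := minDegree_mul_card_atoms_le G
  rw [← hδ, ← hn] at hatoms
  have hcross : (crossEdges G (atoms G)).card ≤ 280 * n := by
    refine (card_crossEdges_atoms_le G).trans (le_trans (Nat.mul_le_mul_right _ ?_) hatoms)
    rw [hδ]
    exact econn_le_minDegree G (hδ ▸ h1)
  have hn1 : (1 : ℝ) ≤ n := by
    rw [hn]
    exact_mod_cast Fintype.card_pos (α := V)
  have hlog : 1 ≤ Real.log ((n : ℝ) + 2) := by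
    rw [Real.le_log_iff_exp_le (by linarith)]
    linarith [Real.exp_one_lt_d9]
  have hbound : 280 * (n : ℝ) ≤ 280 * n * Real.log ((n : ℝ) + 2) :=
    le_mul_of_one_le_right (by linarith) hlog
  refine ⟨atoms G, isPartition_atoms G,
    fun S hS p hp => subset_or_disjoint_of_mem_atoms hS hp, ?_, ?_⟩
  · rw [Real.rpow_one]
    refine le_trans ?_ hbound
    exact_mod_cast hcross
  · rw [Real.rpow_one, le_div_iff₀ (by exact_mod_cast h1)]
    refine le_trans ?_ hbound
    rw [mul_comm]
    exact_mod_cast hatoms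

end
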